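/- Let g : ℝ² → ℝ be a polynomial function such that the function G(z) = (1 − z₁² − z₂²)·g(z) satisfies ΔG(z) = 0 for all z in the open unit disk 𝔻. Then g is identically zero. -/

import Mathlib

open MeasureTheory

noncomputable section

abbrev E2 := EuclideanSpace ℝ (Fin 2)

/-- The Laplacian `Δf = ∂²f/∂z₁² + ∂²f/∂z₂²` of a function on `ℝ²`, computed as the sum of the
second derivatives along the two coordinate axes. -/
def lap2 {F : Type*} [NormedAddCommGroup F] [NormedSpace ℝ F]
    (f : E2 → F) (z : E2) : F :=
  iteratedDeriv 2 (fun s : ℝ => f (z + s • EuclideanSpace.single (0 : Fin 2) (1 : ℝ))) 0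
    + iteratedDeriv 2 (fun s : ℝ => f (z + s • EuclideanSpace.single (1 : Fin 2) (1 : ℝ))) 0

lemma iteratedDeriv_two_nonpos_of_isLocalMax {f : ℝ → ℝ} {x : ℝ} (hf : ContinuousAt f x)
    (hmax : IsLocalMax f x) : iteratedDeriv 2 f x ≤ 0 := by
  by_contra! h
  have hmin : IsLocalMin f x := by
    refine isLocalMin_of_deriv_deriv_pos ?_ hmax.deriv_eq_zero hf
    rwa [iteratedDeriv_succ, iteratedDeriv_one] at h
  have hconst : f =ᶠ[nhds x] fun _ => f x := by
    filter_upwards [hmax, hmin] with y h₁ h₂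
    exact le_antisymm h₁ h₂
  rw [hconst.iteratedDeriv_eq 2] at h
  simp [iteratedDeriv_const] at h

lemma lap2_nonpos_of_isLocalMax {f : E2 → ℝ} {z : E2} (hf : Continuous f)
    (hmax : IsLocalMax f z) : lap2 f z ≤ 0 := by
  have key (v : E2) : iteratedDeriv 2 (fun s : ℝ => f (z + s • v)) 0 ≤ 0 := by
    refine iteratedDeriv_two_nonpos_of_isLocalMax (by fun_prop) ?_
    have hv : Filter.Tendsto (fun s : ℝ => z + s • v) (nhds 0) (nhds z) := by
      have : Continuous fun s : ℝ => z + s • v := by fun_prop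
      simpa using this.tendsto 0
    simpa [IsLocalMax, IsMaxFilter] using hv.eventually hmax
  exact add_nonpos (key _) (key _)

lemma lap2_add {f h : E2 → ℝ} (hf : ContDiff ℝ 2 f) (hh : ContDiff ℝ 2 h) (z : E2) :
    lap2 (fun w => f w + h w) z = lap2 f z + lap2 h z := by
  have key (v : E2) : iteratedDeriv 2 (fun s : ℝ => f (z + s • v) + h (z + s • v)) 0
      = iteratedDeriv 2 (fun s : ℝ => f (z + s • v)) 0
        + iteratedDeriv 2 (fun s : ℝ => h (z + s • v)) 0 := by
    refine iteratedDeriv_fun_add ?_ ?_ <;> exact ContDiff.contDiffAt (by fun_prop)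
  simp only [lap2, key]
  ring

lemma lap2_neg (f : E2 → ℝ) (z : E2) : lap2 (fun w => -f w) z = -lap2 f z := by
  simp only [lap2, iteratedDeriv_fun_neg]
  ring

lemma lap2_const_mul_sq_add_sq (c : ℝ) (z : E2) :
    lap2 (fun w => c * ((w 0) ^ 2 + (w 1) ^ 2)) z = 4 * c := by
  have key (a b : ℝ) : iteratedDeriv 2 (fun s : ℝ => c * ((a + s) ^ 2 + b)) 0 = 2 * c := by
    have h₁ : deriv (fun s : ℝ => c * ((a + s) ^ 2 + b)) = fun s => c * (2 * (a + s)) := by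
      funext s
      have := ((((hasDerivAt_id s).const_add a).pow 2).add_const b).const_mul c
      simpa using this.deriv
    have h₂ : HasDerivAt (fun s : ℝ => c * (2 * (a + s))) (c * (2 * 1)) 0 :=
      (((hasDerivAt_id 0).const_add a).const_mul 2).const_mul c
    rw [iteratedDeriv_succ, iteratedDeriv_one, h₁, h₂.deriv]
    ring
  have h₀ := key (z 0) ((z 1) ^ 2)
  have h₁ := key (z 1) ((z 0) ^ 2)
  simp only [add_comm ((z 1 + _) ^ 2)] at h₁
  simp [lap2, h₀, h₁]
  ring

/-- The weak maximum principle on the unit disk. -/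
lemma nonpos_of_lap2_eq_zero {f : E2 → ℝ} (hf : ContDiff ℝ 2 f)
    (hlap : ∀ z ∈ Metric.ball (0 : E2) 1, lap2 f z = 0)
    (hbd : ∀ z ∈ Metric.sphere (0 : E2) 1, f z ≤ 0) :
    ∀ z ∈ Metric.closedBall (0 : E2) 1, f z ≤ 0 := by
  intro z hz
  refine le_of_forall_pos_le_add fun ε hε => ?_
  let q : E2 → ℝ := fun w => ε * ((w 0) ^ 2 + (w 1) ^ 2)
  have hq : ContDiff ℝ 2 q := by fun_prop
  have hq_eq (w : E2) : q w = ε * ‖w‖ ^ 2 := by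
    simp [q, EuclideanSpace.norm_sq_eq, Fin.sum_univ_two]
  obtain ⟨m, hm, hmax⟩ := (isCompact_closedBall (0 : E2) 1).exists_isMaxOn
    ⟨z, hz⟩ (hf.continuous.add hq.continuous).continuousOn
  have hm_sphere : m ∈ Metric.sphere (0 : E2) 1 := by
    by_contra hne
    have hball : m ∈ Metric.ball (0 : E2) 1 :=
      lt_of_le_of_ne (Metric.mem_closedBall.1 hm) hne
    have hnhds := Metric.closedBall_mem_nhds_of_mem hball
    have hle := lap2_nonpos_of_isLocalMax (hf.continuous.add hq.continuous)
      (hmax.isLocalMax hnhds)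
    have heq := lap2_add hf hq m
    rw [hlap m hball, lap2_const_mul_sq_add_sq] at heq
    change lap2 (fun w => f w + q w) m ≤ 0 at hle
    linarith
  have hle : f z + q z ≤ f m + q m := hmax hz
  have hqm : q m = ε := by
    rw [hq_eq, mem_sphere_zero_iff_norm.1 hm_sphere]
    ring
  have hqz : 0 ≤ q z := by
    rw [hq_eq]
    positivity
  linarith [hbd m hm_sphere]

lemma contDiff_eval_mvPolynomial (p : MvPolynomial (Fin 2) ℝ) {n : WithTop ℕ∞} :
    ContDiff ℝ n fun z : E2 => MvPolynomial.eval (fun i => z i) p := by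
  induction p using MvPolynomial.induction_on with
  | C a => simpa using contDiff_const
  | add p q hp hq => simpa using hp.add hq
  | mul_X p i hp => simpa using hp.mul (by fun_prop)

/-- If `g` is a polynomial function on `ℝ²` such that
`G(z) = (1 − z₁² − z₂²)·g(z)` is harmonic on the open unit disk, then `g` vanishes
identically. -/
theorem harmonic_with_disk_factor_implies_zero
    (g : E2 → ℝ)
    (hg : ∃ p : MvPolynomial (Fin 2) ℝ, ∀ z : E2, g z = MvPolynomial.eval (fun i => z i) p)
    (hG : ∀ z ∈ Metric.ball (0 : E2) 1,
      lap2 (fun w => (1 - (w 0) ^ 2 - (w 1) ^ 2) * g w) z = 0) :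
    ∀ z : E2, g z = 0 := by
  obtain ⟨p, hp⟩ := hg
  let G : E2 → ℝ := fun w => (1 - (w 0) ^ 2 - (w 1) ^ 2) * g w
  have hg_smooth : ContDiff ℝ 2 g := by
    rw [funext hp]
    exact contDiff_eval_mvPolynomial p
  have hG_smooth : ContDiff ℝ 2 G := by fun_prop
  have hG_sphere : ∀ z ∈ Metric.sphere (0 : E2) 1, G z = 0 := by
    intro z hz
    have h := EuclideanSpace.norm_sq_eq z
    rw [mem_sphere_zero_iff_norm.1 hz, Fin.sum_univ_two] at h
    simp only [Real.norm_eq_abs, sq_abs] at h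
    have h₀ : 1 - (z 0) ^ 2 - (z 1) ^ 2 = 0 := by linarith
    simp [G, h₀]
  have hG_zero : ∀ z ∈ Metric.closedBall (0 : E2) 1, G z = 0 := by
    intro z hz
    refine le_antisymm (nonpos_of_lap2_eq_zero hG_smooth hG (fun w hw => (hG_sphere w hw).le) z hz)
      (neg_nonpos.1 (nonpos_of_lap2_eq_zero hG_smooth.neg (fun w hw => ?_)
        (fun w hw => by simp [hG_sphere w hw]) z hz))
    rw [lap2_neg, hG w hw, neg_zero]
  have hp_zero : p = 0 := by
    refine MvPolynomial.funext_set (fun _ => Set.Ioo (0 : ℝ) (1 / 2))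
      (fun _ => Set.Ioo_infinite (by norm_num)) fun x hx => ?_
    have h₀ := hx 0 trivial
    have h₁ := hx 1 trivial
    simp only [Set.mem_Ioo] at h₀ h₁
    have hpos : 0 < 1 - (x 0) ^ 2 - (x 1) ^ 2 := by nlinarith
    have hx_mem : WithLp.toLp 2 x ∈ Metric.closedBall (0 : E2) 1 := by
      rw [mem_closedBall_zero_iff, ← sq_le_one_iff₀ (norm_nonneg _), EuclideanSpace.norm_sq_eq,
        Fin.sum_univ_two]
      simp only [Real.norm_eq_abs, sq_abs]
      linarith
    have hx_eq : g (WithLp.toLp 2 x) = 0 :=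
      (mul_eq_zero.1 (hG_zero _ hx_mem)).resolve_left hpos.ne'
    rw [hp] at hx_eq
    simpa using hx_eq
  intro z
  rw [hp, hp_zero, map_zero]

end
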